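/- Let f be a transcendental entire function. Then there exists a constant C > 0 such that n(r,a) ≤ log M(er, f) + C for all a ∈ ℂ and all r > 1. -/

import Mathlib

open MeasureTheory Filter Metric Set Topology ENNReal

/-- Logarithmic area of a subset of the plane. -/
noncomputable def logArea (A : Set ℂ) : ℝ≥0∞ :=
  ∫⁻ z in A, ENNReal.ofReal ((‖z‖ ^ 2)⁻¹)

/-- The set Δ = {z : |z| ≥ 1}. -/
def Delta : Set ℂ := {z : ℂ | 1 ≤ ‖z‖}

/-- Chordal (spherical) distance on the Riemann sphere ℂ ∪ {∞}, with ∞ encoded as `none`. -/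
noncomputable def chordalDist : Option ℂ → Option ℂ → ℝ
  | none, none => 0
  | none, some w => 2 / Real.sqrt (1 + ‖w‖ ^ 2)
  | some z, none => 2 / Real.sqrt (1 + ‖z‖ ^ 2)
  | some z, some w =>
      2 * ‖z - w‖ / (Real.sqrt (1 + ‖z‖ ^ 2) * Real.sqrt (1 + ‖w‖ ^ 2))

/-- Locally uniform convergence on `U` of a sequence of ℂ-valued functions towards a
function with values in the Riemann sphere, with respect to the spherical metric. -/
def SphLocUnifConvOn (F : ℕ → ℂ → ℂ) (g : ℂ → Option ℂ) (U : Set ℂ) : Prop :=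
  ∀ K : Set ℂ, K ⊆ U → IsCompact K → ∀ ε : ℝ, 0 < ε →
    ∀ᶠ n in atTop, ∀ z ∈ K, chordalDist (some (F n z)) (g z) < ε

/-- The Fatou set: points having a neighborhood on which every sequence of iterates has a
subsequence converging locally uniformly with respect to the spherical metric. -/
def fatouSet (f : ℂ → ℂ) : Set ℂ :=
  {z | ∃ U ∈ 𝓝 z, ∀ φ : ℕ → ℕ, StrictMono φ →
    ∃ ψ : ℕ → ℕ, StrictMono ψ ∧ ∃ g : ℂ → Option ℂ,
      SphLocUnifConvOn (fun n => f^[φ (ψ n)]) g U}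

/-- The Julia set. -/
def juliaSet (f : ℂ → ℂ) : Set ℂ := (fatouSet f)ᶜ

/-- The escaping set. -/
def escapingSet (f : ℂ → ℂ) : Set ℂ :=
  {z | Tendsto (fun n => ‖f^[n] z‖) atTop atTop}

/-- The Fatou set has no multiply connected component. -/
def NoMultiplyConnectedFatouComponent (f : ℂ → ℂ) : Prop :=
  ∀ z ∈ fatouSet f, SimplyConnectedSpace (connectedComponentIn (fatouSet f) z)

/-- Maximum modulus M(r,f). -/
noncomputable def maxMod (f : ℂ → ℂ) (r : ℝ) : ℝ :=
  sSup ((fun z => ‖f z‖) '' {z : ℂ | ‖z‖ = r})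

/-- The order ρ(f) of an entire function, as an extended real number. -/
noncomputable def entireOrder (f : ℂ → ℂ) : EReal :=
  limsup (fun r : ℝ => ((Real.log (Real.log (maxMod f r)) / Real.log r : ℝ) : EReal)) atTop

/-- The fast escaping set A(f). -/
def fastEscapingSet (f : ℂ → ℂ) : Set ℂ :=
  {z | ∃ R : ℝ, 0 < R ∧ (∀ r : ℝ, R ≤ r → r < maxMod f r) ∧
    ∃ L : ℕ, ∀ n : ℕ, L < n → (maxMod f)^[n - L] R ≤ ‖f^[n] z‖}

/-- `f` is a transcendental entire function. -/
def TranscendentalEntire (f : ℂ → ℂ) : Prop :=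
  Differentiable ℂ f ∧ ¬ ∃ p : Polynomial ℂ, ∀ z, f z = p.eval z

/-- Order of vanishing of `g` at `z` (the least `k` with nonzero `k`-th derivative). -/
noncomputable def vanishingOrder (g : ℂ → ℂ) (z : ℂ) : ℕ :=
  sInf {k : ℕ | iteratedDeriv k g z ≠ 0}

/-- n(r,a): the number of solutions of f(z) = a with |z| ≤ r, counted with multiplicity. -/
noncomputable def nCount (f : ℂ → ℂ) (a : ℂ) (r : ℝ) : ℕ :=
  ∑ᶠ z ∈ {z : ℂ | ‖z‖ ≤ r ∧ f z = a}, vanishingOrder (fun w => f w - a) z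

/-- n(r) = max over a of n(r,a). -/
noncomputable def nMax (f : ℂ → ℂ) (r : ℝ) : ℕ := ⨆ a : ℂ, nCount f a r

/-- Critical values of `f`. -/
def criticalValues (f : ℂ → ℂ) : Set ℂ := {w | ∃ z, deriv f z = 0 ∧ f z = w}

/-- Finite asymptotic values of `f`. -/
def asymptoticValues (f : ℂ → ℂ) : Set ℂ :=
  {w | ∃ γ : ℝ → ℂ, Continuous γ ∧ Tendsto (fun t => ‖γ t‖) atTop atTop ∧
    Tendsto (fun t => f (γ t)) atTop (𝓝 w)}

/-- The Eremenko–Lyubich class B. -/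
def ELClass (f : ℂ → ℂ) : Prop :=
  TranscendentalEntire f ∧ Bornology.IsBounded (criticalValues f ∪ asymptoticValues f)

/-- Semihyperbolic polynomial. -/
def SemiHyperbolic (p : Polynomial ℂ) : Prop :=
  ∃ ε : ℝ, 0 < ε ∧ ∃ N : ℕ, ∀ z ∈ juliaSet (fun w => p.eval w), ∀ n : ℕ, 1 ≤ n →
    ∀ V : Set ℂ, (∃ u ∈ (fun w => p.eval w)^[n] ⁻¹' ball z ε,
        V = connectedComponentIn ((fun w => p.eval w)^[n] ⁻¹' ball z ε) u) →
      ∀ w ∈ ball z ε,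
        (∑ᶠ u ∈ {u : ℂ | u ∈ V ∧ (fun v => p.eval v)^[n] u = w},
          vanishingOrder (fun ζ => (fun v => p.eval v)^[n] ζ - w) u) ≤ N

/-- The logarithm of the distance to `ρ` is dominated by its Poisson integral. -/
lemma log_norm_sub_le_circleAverage_poissonKernel {w ρ : ℂ} (hw : w ∈ ball (0 : ℂ) 1)
    (hρ : ρ ∈ closedBall (0 : ℂ) 1) (hwρ : w ≠ ρ) :
    Real.log ‖w - ρ‖ ≤
      Real.circleAverage (poissonKernel 0 w • fun z ↦ Real.log ‖z - ρ‖) 0 1 := by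
  have hw1 : ‖w‖ < 1 := by simpa using hw
  rcases (mem_closedBall_zero_iff.mp hρ).lt_or_eq with h | h
  · have key (z : ℂ) (hz : ‖z‖ ≤ 1) : 1 - (starRingEnd ℂ) ρ * z ≠ 0 := by
      intro h0
      have h1 : ‖(starRingEnd ℂ) ρ * z‖ = 1 := by
        rw [← sub_eq_zero.mp h0]; simp
      rw [norm_mul, RCLike.norm_conj] at h1
      nlinarith [norm_nonneg ρ, norm_nonneg z]
    have normSq_diff (z : ℂ) : ‖1 - (starRingEnd ℂ) ρ * z‖ ^ 2 - ‖z - ρ‖ ^ 2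
        = (1 - ‖z‖ ^ 2) * (1 - ‖ρ‖ ^ 2) := by
      simp only [← Complex.normSq_eq_norm_sq, Complex.normSq_apply]
      simp
      ring
    have hcongr : EqOn (poissonKernel 0 w • fun z ↦ Real.log ‖z - ρ‖)
        (poissonKernel 0 w • fun z ↦ Real.log ‖1 - (starRingEnd ℂ) ρ * z‖) (sphere 0 |1|) := by
      intro z hz
      have hz1 : ‖z‖ = 1 := by simpa using hz
      have h2 := normSq_diff z
      have h3 : ‖1 - (starRingEnd ℂ) ρ * z‖ = ‖z - ρ‖ := by
        rw [hz1] at h2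
        exact (sq_eq_sq₀ (norm_nonneg _) (norm_nonneg _)).mp (by linarith)
      simp [h3]
    rw [Real.circleAverage_congr_sphere hcongr,
      InnerProductSpace.HarmonicOnNhd.circleAverage_poissonKernel_smul _ hw]
    · apply Real.log_le_log (norm_pos_iff.mpr (sub_ne_zero.mpr hwρ))
      refine (sq_le_sq₀ (norm_nonneg _) (norm_nonneg _)).mp ?_
      have := normSq_diff w
      nlinarith [mul_nonneg (show 0 ≤ 1 - ‖w‖ ^ 2 by nlinarith [norm_nonneg w])
        (show 0 ≤ 1 - ‖ρ‖ ^ 2 by nlinarith [norm_nonneg ρ])]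
    · intro z hz
      exact AnalyticAt.harmonicAt_log_norm (f := fun z ↦ 1 - (starRingEnd ℂ) ρ * z) (by fun_prop)
        (key z (by simpa using hz))
  · have := circleAverage_re_herglotzRieszKernel_mul_log (w := w) (ρ := ρ) (c := 0) (R := 1)
      (by simpa using h) hw
    rw [← this, ← poissonKernel_eq_re_herglotzRieszKernel]
    rfl

lemma continuousOn_poissonKernel_sphere {w : ℂ} (hw : w ∈ ball (0 : ℂ) 1) :
    ContinuousOn (poissonKernel 0 w) (sphere 0 |1|) := by
  rw [poissonKernel_eq_re_herglotzRieszKernel]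
  exact Complex.continuous_re.comp_continuousOn (continuousOn_herglotzRieszKernel_sphere hw)

lemma CircleIntegrable.poissonKernel_smul {w : ℂ} (hw : w ∈ ball (0 : ℂ) 1) {u : ℂ → ℝ}
    (hu : CircleIntegrable u 0 1) : CircleIntegrable (poissonKernel 0 w • u) 0 1 := by
  refine IntervalIntegrable.continuousOn_mul (f := fun θ ↦ u (circleMap 0 1 θ)) hu
    (g := fun θ ↦ poissonKernel 0 w (circleMap 0 1 θ)) ?_
  exact (continuousOn_poissonKernel_sphere hw).comp (continuous_circleMap 0 1).continuousOn
    fun θ _ ↦ circleMap_mem_sphere' 0 1 θ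

/-- **Poisson–Jensen inequality** on the unit disc. -/
lemma AnalyticOnNhd.log_norm_le_circleAverage_poissonKernel {g : ℂ → ℂ}
    (hg : AnalyticOnNhd ℂ g (closedBall 0 1)) {w : ℂ} (hw : w ∈ ball (0 : ℂ) 1) (hgw : g w ≠ 0) :
    Real.log ‖g w‖ ≤
      Real.circleAverage (poissonKernel 0 w • fun z ↦ Real.log ‖g z‖) 0 1 := by
  have hwc : w ∈ closedBall (0 : ℂ) 1 := ball_subset_closedBall hw
  have hord : ∀ u : closedBall (0 : ℂ) 1, meromorphicOrderAt g u ≠ ⊤ := by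
    rw [← hg.meromorphicOn.exists_meromorphicOrderAt_ne_top_iff_forall
      ⟨⟨0, by simp⟩, (convex_closedBall (0 : ℂ) 1).isPreconnected⟩]
    refine ⟨⟨w, hwc⟩, ?_⟩
    rw [(hg w hwc).meromorphicOrderAt_eq, (hg w hwc).analyticOrderAt_eq_zero.mpr hgw]
    simp
  set D := MeromorphicOn.divisor g (closedBall (0 : ℂ) 1) with hD
  have hfin : D.support.Finite := D.finiteSupport (isCompact_closedBall 0 1)
  have hDnn (u : ℂ) : 0 ≤ D u := MeromorphicOn.AnalyticOnNhd.divisor_nonneg hg u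
  have hDw : D w = 0 := by
    rw [hD, MeromorphicOn.AnalyticOnNhd.divisor_apply hg hwc,
      (hg w hwc).analyticOrderAt_eq_zero.mpr hgw]
    simp
  obtain ⟨h, hh, hh0, hgh⟩ := hg.meromorphicOn.extract_zeros_poles hord hfin
  have hlog := MeromorphicOn.extract_zeros_poles_log hh0 hgh
  have hsum : (∑ᶠ u, (D u * Real.log ‖· - u‖) : ℂ → ℝ)
      = ∑ u ∈ hfin.toFinset, (fun z ↦ D u * Real.log ‖z - u‖) := by
    rw [finsum_eq_sum_of_support_subset]
    intro u
    contrapose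
    intro hu
    have : D u = 0 := by simpa using hu
    simp [this, Pi.zero_def]
  rw [← hD, hsum] at hlog
  set S := hfin.toFinset
  have hSc {u : ℂ} (hu : u ∈ S) : u ∈ closedBall (0 : ℂ) 1 :=
    D.supportWithinDomain (by simpa [S] using hu)
  have hSw {u : ℂ} (hu : u ∈ S) : w ≠ u := by
    rintro rfl
    simp [S, hDw] at hu
  have hhw (z : ℂ) (hz : z ∈ closedBall (0 : ℂ) 1) :
      InnerProductSpace.HarmonicAt (fun z ↦ Real.log ‖h z‖) z :=
    (hh z hz).harmonicAt_log_norm (hh0 ⟨z, hz⟩)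
  -- the factorization of `log ‖g ·‖` holds at `w` itself
  have hat : Real.log ‖g w‖ = ∑ u ∈ S, D u * Real.log ‖w - u‖ + Real.log ‖h w‖ := by
    have h1 : (fun z ↦ Real.log ‖g z‖) =ᶠ[𝓝[≠] w]
        fun z ↦ ∑ u ∈ S, D u * Real.log ‖z - u‖ + Real.log ‖h z‖ := by
      have h2 := mem_codiscreteWithin_iff_forall_mem_nhdsNE.mp hlog w hwc
      filter_upwards [h2, nhdsWithin_le_nhds (closedBall_mem_nhds_of_mem hw)] with z hz hz'
      rcases hz with hz | hz
      · simpa using hz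
      · exact absurd hz' hz
    refine ((ContinuousAt.eventuallyEq_nhds_iff_eventuallyEq_nhdsNE ?_ ?_).mp h1).eq_of_nhds
    · exact (hg w hwc).continuousAt.norm.log (by simpa using hgw)
    · refine ContinuousAt.add (tendsto_finsetSum _ fun u hu ↦ ?_) (hhw w hwc).1.continuousAt
      refine continuousAt_const.mul (ContinuousAt.log (by fun_prop) ?_)
      simpa [sub_eq_zero] using hSw hu
  have hint (u : ℂ) : CircleIntegrable (fun z ↦ Real.log ‖z - u‖) 0 1 :=
    circleIntegrable_log_norm_sub_const 1
  have hinth : CircleIntegrable (fun z ↦ Real.log ‖h z‖) 0 1 :=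
    (hh.mono (by simpa using sphere_subset_closedBall)).meromorphicOn.circleIntegrable_log_norm
  have hcongr : poissonKernel 0 w • (fun z ↦ Real.log ‖g z‖)
      =ᶠ[codiscreteWithin (sphere (0 : ℂ) |1|)]
        (∑ u ∈ S, (D u : ℝ) • poissonKernel 0 w • (fun z ↦ Real.log ‖z - u‖))
          + poissonKernel 0 w • (fun z ↦ Real.log ‖h z‖) := by
    filter_upwards [codiscreteWithin_mono (by simpa using sphere_subset_closedBall) hlog] with z hz
    simp only [Pi.smul_apply', Pi.add_apply, Finset.sum_apply, Pi.smul_apply, smul_eq_mul] at hz ⊢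
    rw [hz, mul_add, Finset.mul_sum]
    congr 1
    refine Finset.sum_congr rfl fun u _ ↦ ?_
    simp only [Pi.mul_apply]
    ring
  rw [Real.circleAverage_congr_codiscreteWithin hcongr one_ne_zero, Real.circleAverage_add,
    Real.circleAverage_sum, InnerProductSpace.HarmonicOnNhd.circleAverage_poissonKernel_smul hhw hw,
    hat]
  · gcongr with u hu
    rw [Real.circleAverage_smul, smul_eq_mul]
    gcongr
    · exact_mod_cast hDnn u
    · exact log_norm_sub_le_circleAverage_poissonKernel hw (hSc hu) (hSw hu)
  · exact fun u _ ↦ ((hint u).poissonKernel_smul hw).const_smul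
  · exact CircleIntegrable.sum _ fun u _ ↦ ((hint u).poissonKernel_smul hw).const_smul
  · exact hinth.poissonKernel_smul hw

/-- A Harnack-type lower bound for the mean of `log ‖g ·‖` over the unit circle. -/
lemma AnalyticOnNhd.log_norm_le_mul_circleAverage_add {g : ℂ → ℂ}
    (hg : AnalyticOnNhd ℂ g (closedBall 0 1)) {w : ℂ} (hw : w ∈ ball (0 : ℂ) 1) (hgw : g w ≠ 0)
    {K : ℝ} (hK : 1 ≤ K) (hgK : ∀ z ∈ sphere (0 : ℂ) 1, ‖g z‖ ≤ K) :
    Real.log ‖g w‖ ≤ (1 - ‖w‖) / (1 + ‖w‖) * Real.circleAverage (fun z ↦ Real.log ‖g z‖) 0 1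
      + (1 + ‖w‖) / (1 - ‖w‖) * Real.log K := by
  have hint : CircleIntegrable (fun z ↦ Real.log ‖g z‖) 0 1 :=
    (hg.mono (by simpa using sphere_subset_closedBall)).meromorphicOn.circleIntegrable_log_norm
  rw [← smul_eq_mul, ← Real.circleAverage_smul,
    ← Real.circleAverage_const ((1 + ‖w‖) / (1 - ‖w‖) * Real.log K) (0 : ℂ) 1,
    ← Real.circleAverage_add hint.const_smul (circleIntegrable_const _ _ _)]
  refine (hg.log_norm_le_circleAverage_poissonKernel hw hgw).trans <|
    Real.circleAverage_mono (hint.poissonKernel_smul hw)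
      (hint.const_smul.add (circleIntegrable_const _ _ _)) fun z hz ↦ ?_
  have hz1 : z ∈ sphere (0 : ℂ) 1 := by simpa using hz
  have hlow := le_re_herglotzRieszKernel hz1 hw
  have hupp := re_herglotzRieszKernel_le hz1 hw
  have hP : poissonKernel 0 w z = ((z - 0 + (w - 0)) / ((z - 0) - (w - 0))).re :=
    congrFun poissonKernel_eq_re_herglotzRieszKernel z
  rw [← hP] at hlow hupp
  simp only [sub_zero] at hlow hupp
  have hw1 : ‖w‖ < 1 := by simpa using hw
  have hpos : 0 ≤ (1 - ‖w‖) / (1 + ‖w‖) := div_nonneg (by linarith) (by positivity)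
  have hlK : 0 ≤ Real.log K := Real.log_nonneg hK
  have hle : Real.log ‖g z‖ ≤ Real.log K := by
    rcases eq_or_ne (g z) 0 with h0 | h0
    · simpa [h0] using hlK
    · exact Real.log_le_log (norm_pos_iff.mpr h0) (hgK z hz1)
  simp only [Pi.smul_apply', Pi.add_apply, Pi.smul_apply, smul_eq_mul]
  nlinarith [mul_nonneg (sub_nonneg.mpr hlow) (sub_nonneg.mpr hle), mul_nonneg hpos hlK,
    mul_nonneg (sub_nonneg.mpr hupp) hlK]

/-- For a function that is not constant on the unit disc, the means of `log ‖f · - a‖` over the unit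
circle are bounded below uniformly in `a`. -/
lemma exists_forall_neg_le_circleAverage_log_norm_sub {f : ℂ → ℂ}
    (hf : AnalyticOnNhd ℂ f (closedBall 0 1)) {w : ℂ} (hw : w ∈ ball (0 : ℂ) 1) (hfw : f w ≠ f 0) :
    ∃ L : ℝ, ∀ a : ℂ, -L ≤ Real.circleAverage (fun z ↦ Real.log ‖f z - a‖) 0 1 := by
  obtain ⟨B, hB⟩ := (isCompact_closedBall (0 : ℂ) 1).exists_bound_of_continuousOn hf.continuousOn
  have hB0 : 0 ≤ B := (norm_nonneg _).trans (hB 0 (by simp))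
  set δ := ‖f w - f 0‖ / 2 with hδ
  have hδ0 : 0 < δ := half_pos (norm_pos_iff.mpr (sub_ne_zero.mpr hfw))
  set K := 2 * B + 1 with hK
  let p (v : ℂ) : ℝ := (1 - ‖v‖) / (1 + ‖v‖)
  let q (v : ℂ) : ℝ := (1 + ‖v‖) / (1 - ‖v‖)
  let l (v : ℂ) : ℝ := |(Real.log δ - q v * Real.log K) / p v|
  refine ⟨l 0 + l w, fun a ↦ ?_⟩
  have hl0 : 0 ≤ l 0 := abs_nonneg _
  have hlw : 0 ≤ l w := abs_nonneg _
  rcases le_or_gt (B + 1) ‖a‖ with ha | ha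
  · have : 0 ≤ Real.circleAverage (fun z ↦ Real.log ‖f z - a‖) 0 1 := by
      refine Real.circleAverage_nonneg_of_nonneg fun z hz ↦ Real.log_nonneg ?_
      have h1 := hB z (sphere_subset_closedBall (by simpa using hz))
      have h2 := norm_sub_norm_le a (f z)
      rw [norm_sub_rev] at h2
      linarith
    linarith
  · have key (v : ℂ) (hv : v ∈ ball (0 : ℂ) 1) (hδv : δ ≤ ‖f v - a‖) :
        -l v ≤ Real.circleAverage (fun z ↦ Real.log ‖f z - a‖) 0 1 := by
      have hv1 : ‖v‖ < 1 := by simpa using hv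
      have hp : 0 < p v := div_pos (by linarith) (by positivity)
      have h1 := AnalyticOnNhd.log_norm_le_mul_circleAverage_add (g := fun z ↦ f z - a)
        (hf.sub analyticOnNhd_const) hv (norm_pos_iff.mp (hδ0.trans_le hδv))
        (K := K) (by linarith) fun z hz ↦ by
          linarith [norm_sub_le (f z) a, hB z (sphere_subset_closedBall hz)]
      have h2 := Real.log_le_log hδ0 hδv
      refine (neg_abs_le _).trans ((div_le_iff₀ hp).mpr ?_)
      change _ ≤ p v * _ + q v * _ at h1
      linarith
    have htri : 2 * δ ≤ ‖f w - a‖ + ‖f 0 - a‖ := by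
      have := norm_sub_le (f w - a) (f 0 - a)
      rw [sub_sub_sub_cancel_right] at this
      linarith
    rcases le_total δ ‖f w - a‖ with h | h
    · linarith [key w hw h]
    · linarith [key 0 (by simp) (by linarith)]

/-- Jensen's formula for entire functions, as a sum over a finite set of points. -/
lemma circleAverage_log_norm_eq_sum {g : ℂ → ℂ} (hg : Differentiable ℂ g)
    {R : ℝ} (hR : 0 < R) {S : Finset ℂ} (hS : ∀ z, g z = 0 → ‖z‖ ≤ R → z ∈ S) :
    Real.circleAverage (fun z ↦ Real.log ‖g z‖) 0 R
      = ∑ z ∈ S, (if ‖z‖ ≤ R then (analyticOrderNatAt g z : ℝ) else 0) * Real.log (R * ‖z‖⁻¹)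
        + analyticOrderNatAt g 0 * Real.log R + Real.log ‖meromorphicTrailingCoeffAt g 0‖ := by
  have hgR : AnalyticOnNhd ℂ g (closedBall 0 |R|) := fun z _ ↦ hg.analyticAt z
  have hdiv (z : ℂ) : (MeromorphicOn.divisor g (closedBall 0 |R|) z : ℝ)
      = if ‖z‖ ≤ R then (analyticOrderNatAt g z : ℝ) else 0 := by
    split_ifs with hz
    · rw [MeromorphicOn.AnalyticOnNhd.divisor_apply hgR (by simpa [abs_of_pos hR] using hz),
        analyticOrderNatAt]
      cases analyticOrderAt g z <;> simp
    · rw [Function.locallyFinsuppWithin.apply_eq_zero_of_notMem _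
        (by simpa [abs_of_pos hR] using hz)]
      simp
  rw [hgR.meromorphicOn.circleAverage_log_norm hR.ne']
  simp only [hdiv, zero_sub, norm_neg, norm_zero, hR.le, if_true]
  congr 2
  refine finsum_eq_sum_of_support_subset _ fun z hz ↦ ?_
  by_contra hzS
  refine hz ?_
  dsimp only
  split_ifs with hzR
  · have : g z ≠ 0 := fun h0 ↦ hzS (hS z h0 hzR)
    have : analyticOrderAt g z = 0 := (hg.analyticAt z).analyticOrderAt_eq_zero.mpr this
    simp [analyticOrderNatAt, this]
  · simp

lemma vanishingOrder_eq_analyticOrderNatAt {g : ℂ → ℂ} {z : ℂ} (hg : AnalyticAt ℂ g z)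
    (h : analyticOrderAt g z ≠ ⊤) : vanishingOrder g z = analyticOrderNatAt g z := by
  obtain ⟨h1, h2⟩ := (analyticOrderAt_eq_nat_iff_iteratedDeriv_eq_zero hg).mp
    (Nat.cast_analyticOrderNatAt h).symm
  refine le_antisymm (Nat.sInf_le h2) (le_csInf ⟨_, h2⟩ fun k hk ↦ ?_)
  by_contra! hlt
  exact hk (h1 k hlt)

/-- The number of `a`-points in a disc is bounded by the difference of two logarithmic means. -/
lemma nCount_le_circleAverage_sub {f : ℂ → ℂ} (hf : Differentiable ℂ f) {a : ℂ}
    (hfa : ∃ z, f z ≠ a) {r : ℝ} (hr : 1 < r) :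
    (nCount f a r : ℝ) ≤ Real.circleAverage (fun z ↦ Real.log ‖f z - a‖) 0 (Real.exp 1 * r)
      - Real.circleAverage (fun z ↦ Real.log ‖f z - a‖) 0 1 := by
  set g : ℂ → ℂ := fun z ↦ f z - a with hgdef
  have hg : Differentiable ℂ g := hf.sub_const a
  have hgan : AnalyticOnNhd ℂ g univ := fun z _ ↦ hg.analyticAt z
  set R := Real.exp 1 * r with hR
  have he : 1 < Real.exp 1 := Real.one_lt_exp_iff.mpr one_pos
  have hrR : r ≤ R := by nlinarith
  have hR0 : 0 < R := by linarith
  obtain ⟨w, hw⟩ := hfa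
  have hgw : g w ≠ 0 := sub_ne_zero.mpr hw
  have hord (z : ℂ) : analyticOrderAt g z ≠ ⊤ := by
    refine hgan.analyticOrderAt_ne_top_of_isPreconnected isPreconnected_univ (mem_univ w)
      (mem_univ z) ?_
    simp [(hg.analyticAt w).analyticOrderAt_eq_zero.mpr hgw]
  have hfin : {z | g z = 0 ∧ ‖z‖ ≤ R}.Finite := by
    have hgR : AnalyticOnNhd ℂ g (closedBall 0 R) := hgan.mono (subset_univ _)
    refine ((MeromorphicOn.divisor g (closedBall 0 R)).finiteSupport
      (isCompact_closedBall 0 R)).subset fun z ⟨hz0, hzR⟩ ↦ ?_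
    rw [Function.mem_support, MeromorphicOn.AnalyticOnNhd.divisor_apply hgR (by simpa using hzR)]
    have : analyticOrderAt g z ≠ 0 := (hg.analyticAt z).analyticOrderAt_ne_zero.mpr hz0
    have := hord z
    cases h : analyticOrderAt g z <;> simp_all
  set S := hfin.toFinset with hSdef
  have hS (z : ℂ) (h0 : g z = 0) (hz : ‖z‖ ≤ R) : z ∈ S := by simp [S, h0, hz]
  have hn : (nCount f a r : ℝ)
      = ∑ z ∈ S, if ‖z‖ ≤ r then (analyticOrderNatAt g z : ℝ) else 0 := by
    rw [nCount, finsum_mem_eq_sum_of_subset (t := S.filter (‖·‖ ≤ r)), Finset.sum_filter]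
    · push_cast
      refine Finset.sum_congr rfl fun z _ ↦ ?_
      rw [vanishingOrder_eq_analyticOrderNatAt (hg.analyticAt z) (hord z)]
    · rintro z ⟨⟨hz, hza⟩, -⟩
      simpa using ⟨hS z (sub_eq_zero.mpr hza) (hz.trans hrR), hz⟩
    · intro z hz
      simp only [Finset.coe_filter, mem_ofPred_eq, S, Finite.mem_toFinset] at hz
      exact ⟨hz.2, sub_eq_zero.mp hz.1.1⟩
  have h0 : (analyticOrderNatAt g 0 : ℝ) * Real.log R
      = ∑ z ∈ S, if z = 0 then (analyticOrderNatAt g z : ℝ) * Real.log R else 0 := by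
    rw [Finset.sum_ite_eq' S 0]
    split_ifs with h
    · rfl
    · have : g 0 ≠ 0 := fun h0 ↦ h (hS 0 h0 (by simpa using hR0.le))
      simp [analyticOrderNatAt, (hg.analyticAt 0).analyticOrderAt_eq_zero.mpr this]
  rw [circleAverage_log_norm_eq_sum hg hR0 hS,
    circleAverage_log_norm_eq_sum hg one_pos fun z hz hz1 ↦ hS z hz (by linarith),
    hn, Real.log_one, h0]
  rw [mul_zero, add_zero, add_sub_add_right_eq_sub, ← Finset.sum_add_distrib,
    ← Finset.sum_sub_distrib]
  refine Finset.sum_le_sum fun z hz ↦ ?_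
  have hzR : ‖z‖ ≤ R := by simp [S] at hz; exact hz.2
  have hd : (0 : ℝ) ≤ analyticOrderNatAt g z := Nat.cast_nonneg _
  have hlogR : Real.log R = 1 + Real.log r := by
    rw [hR, Real.log_mul (by positivity) (by positivity), Real.log_exp]
  have hlogr : 0 < Real.log r := Real.log_pos hr
  rw [if_pos hzR]
  rcases eq_or_ne z 0 with rfl | hz0
  · simp [show (0 : ℝ) ≤ r by linarith]
    nlinarith
  have hzpos : 0 < ‖z‖ := norm_pos_iff.mpr hz0
  rw [if_neg hz0, Real.log_mul hR0.ne' (by positivity), one_mul, Real.log_inv, hlogR]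
  split_ifs with h1 h2 h2
  · nlinarith
  · have := Real.log_le_log hzpos h1
    nlinarith
  · linarith
  · have := Real.log_le_log hzpos hzR
    rw [hlogR] at this
    nlinarith

lemma TranscendentalEntire.exists_ne {f : ℂ → ℂ} (hf : TranscendentalEntire f) :
    ∃ w ∈ ball (0 : ℂ) 1, f w ≠ f 0 := by
  by_contra! h
  refine hf.2 ⟨Polynomial.C (f 0), fun z ↦ ?_⟩
  have hfan : AnalyticOnNhd ℂ f univ := fun z _ ↦ hf.1.analyticAt z
  rw [Polynomial.eval_C]
  refine congrFun (hfan.eq_of_eventuallyEq (g := fun _ ↦ f 0) (fun z _ ↦ analyticAt_const)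
    (z₀ := 0) ?_) z
  filter_upwards [ball_mem_nhds (0 : ℂ) one_pos] with z hz using h z hz

lemma norm_le_maxMod {f : ℂ → ℂ} (hf : Differentiable ℂ f) {R : ℝ} (hR : 0 < R) {z : ℂ}
    (hz : ‖z‖ ≤ R) : ‖f z‖ ≤ maxMod f R := by
  refine Complex.norm_le_of_forall_mem_frontier_norm_le (isBounded_ball (x := (0 : ℂ)) (r := R))
    hf.diffContOnCl (fun v hv ↦ ?_) (by rw [closure_ball _ hR.ne']; simpa using hz)
  rw [frontier_ball _ hR.ne', mem_sphere_zero_iff_norm] at hv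
  have hset : {z : ℂ | ‖z‖ = R} = sphere 0 R := by ext; simp
  refine le_csSup ?_ (mem_image_of_mem _ hv)
  rw [hset]
  exact ((isCompact_sphere (0 : ℂ) R).image hf.continuous.norm).bddAbove

theorem nCount_le_log_maxMod
    (f : ℂ → ℂ) (hf : TranscendentalEntire f) :
    ∃ C : ℝ, 0 < C ∧ ∀ a : ℂ, ∀ r : ℝ, 1 < r →
      (nCount f a r : ℝ) ≤ Real.log (maxMod f (Real.exp 1 * r)) + C := by
  obtain ⟨w, hw, hfw⟩ := hf.exists_ne
  have hd := hf.1
  obtain ⟨L, hL⟩ := exists_forall_neg_le_circleAverage_log_norm_sub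
    (fun z _ ↦ hd.analyticAt z) hw hfw
  set B := maxMod f 1 with hB
  have hB0 : 0 < B := by
    by_contra! h
    have h1 : f w = 0 := norm_le_zero_iff.mp
      ((norm_le_maxMod hd one_pos (by simpa using ball_subset_closedBall hw)).trans h)
    have h2 : f 0 = 0 := norm_le_zero_iff.mp
      ((norm_le_maxMod hd one_pos (by simp)).trans h)
    exact hfw (h1.trans h2.symm)
  refine ⟨|Real.log B| + |L| + |Real.log (2 * B)| + Real.log 2 + 1, by positivity,
    fun a r hr ↦ ?_⟩
  have he : 1 < Real.exp 1 := Real.one_lt_exp_iff.mpr one_pos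
  set R := Real.exp 1 * r with hR
  have hrR : r ≤ R := by nlinarith
  have hR0 : 0 < R := by linarith
  set M := maxMod f R with hM
  have hBM : B ≤ M := by
    refine csSup_le ⟨_, mem_image_of_mem _ (show ‖(1 : ℂ)‖ = 1 by simp)⟩ ?_
    rintro _ ⟨z, hz, rfl⟩
    exact norm_le_maxMod hd hR0 (by rw [show ‖z‖ = 1 from hz]; linarith)
  have hM0 : 0 < M := hB0.trans_le hBM
  have hlog2 : 0 < Real.log 2 := Real.log_pos one_lt_two
  have hlogBM := Real.log_le_log hB0 hBM
  rcases lt_or_ge M ‖a‖ with ha | ha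
  · have hempty : {z : ℂ | ‖z‖ ≤ r ∧ f z = a} = ∅ := by
      refine eq_empty_of_forall_notMem fun z hz ↦ ?_
      have := norm_le_maxMod hd hR0 (hz.1.trans hrR)
      rw [hz.2] at this
      linarith
    rw [nCount, hempty, finsum_mem_empty, Nat.cast_zero]
    linarith [neg_abs_le (Real.log B), abs_nonneg L, abs_nonneg (Real.log (2 * B))]
  · have hlog2M : Real.log (2 * M) = Real.log 2 + Real.log M :=
      Real.log_mul two_ne_zero hM0.ne'
    have hupp : Real.circleAverage (fun z ↦ Real.log ‖f z - a‖) 0 R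
        ≤ Real.log (2 * M) + |Real.log (2 * B)| := by
      refine Real.circleAverage_mono_on_of_le_circle
        (MeromorphicOn.circleIntegrable_log_norm (f := fun z ↦ f z - a) fun z _ ↦
          ((hd.analyticAt z).sub analyticAt_const).meromorphicAt) fun z hz ↦ ?_
      have hz : ‖z‖ = R := by simpa [abs_of_pos hR0] using hz
      rcases eq_or_ne (f z - a) 0 with h0 | h0
      · rw [h0, norm_zero, Real.log_zero]
        linarith [neg_abs_le (Real.log (2 * B)),
          Real.log_le_log (show 0 < 2 * B by linarith) (show 2 * B ≤ 2 * M by linarith)]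
      · have h1 : ‖f z - a‖ ≤ 2 * M := by
          linarith [norm_sub_le (f z) a, norm_le_maxMod hd hR0 hz.le]
        linarith [Real.log_le_log (norm_pos_iff.mpr h0) h1, abs_nonneg (Real.log (2 * B))]
    have hfa : ∃ z, f z ≠ a := by
      by_contra! h
      exact hfw ((h w).trans (h 0).symm)
    linarith [nCount_le_circleAverage_sub hd hfa hr, hL a, le_abs_self L,
      abs_nonneg (Real.log B)]
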